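/- Let E be a real vector space equipped with a norm ‖·‖_E, and let F ⊆ E be a subspace equipped with a norm ‖·‖_F satisfying ‖x‖_E ≤ ‖x‖_F for all x ∈ F. Let Φ : E → E be a map with Φ(0) = 0, and suppose there are constants ρ ∈ [0,1) and ε > 0, ε' > 0 such that: (i) ‖Φ(x)‖_E ≤ ρ‖x‖_E whenever ‖x‖_E ≤ ε; (ii) Φ maps the set {x : ‖x‖_E ≤ ε} into F, and for every η > 0 there is δ > 0 such that ‖x‖_E ≤ δ implies ‖Φ(x)‖_F ≤ η; (iii) ‖Φ(x)‖_F ≤ ρ‖x‖_F whenever x ∈ F and ‖x‖_F ≤ ε'. Then for every x₀ ∈ E with ‖x₀‖_E ≤ ε, the iterates x_{i+1} = Φ(x_i) satisfy ‖x_i‖_E → 0, and there exists an index I such that for all i ≥ I one has x_i ∈ F, ‖x_i‖_F ≤ ε', and ‖x_i‖_F → 0 as i → ∞. -/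

import Mathlib

open Filter

/-- If `Φ` contracts the norm by a factor `ρ ≤ 1` on the closed `ε`-ball, then the iterates
starting in that ball decay geometrically. -/
lemma norm_iterate_le_pow_mul {E : Type*} [SeminormedAddCommGroup E] {Φ : E → E} {ρ ε : ℝ}
    (hρ0 : 0 ≤ ρ) (hρ1 : ρ ≤ 1) (hΦ : ∀ x : E, ‖x‖ ≤ ε → ‖Φ x‖ ≤ ρ * ‖x‖)
    {x : E} (hx : ‖x‖ ≤ ε) (i : ℕ) : ‖Φ^[i] x‖ ≤ ρ ^ i * ‖x‖ := by
  induction i with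
  | zero => simp
  | succ i ih =>
    have hball : ‖Φ^[i] x‖ ≤ ε :=
      ih.trans ((mul_le_of_le_one_left (norm_nonneg x) (pow_le_one₀ hρ0 hρ1)).trans hx)
    rw [Function.iterate_succ_apply', pow_succ', mul_assoc]
    exact (hΦ _ hball).trans (mul_le_mul_of_nonneg_left ih hρ0)

/-- The two-norm bootstrapping skeleton of the proof of Theorem 3.1(ii) of the paper:
`E` is a real normed space, `F ⊆ E` a subspace carrying a (stronger) norm `nF` with
`‖x‖ ≤ nF x` on `F`; `Φ` fixes `0`, contracts the `E`-norm on the `ε`-ball, maps that ball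
into `F` with `nF ∘ Φ` small near `0`, and contracts `nF` on the `ε'`-ball of `F`.
Then iterates of `Φ` starting `ε`-close to `0` converge to `0` in the `E`-norm, eventually lie
in `F` with `nF` at most `ε'`, and converge to `0` in the `nF`-norm as well. -/
theorem stmt6 {E : Type*} [NormedAddCommGroup E] [NormedSpace ℝ E]
    (F : Submodule ℝ E) (nF : E → ℝ)
    (hdom : ∀ x ∈ F, ‖x‖ ≤ nF x)
    (htri : ∀ x ∈ F, ∀ y ∈ F, nF (x + y) ≤ nF x + nF y)
    (hsmul : ∀ (c : ℝ), ∀ x ∈ F, nF (c • x) = |c| * nF x)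
    (hdef : ∀ x ∈ F, (nF x = 0 ↔ x = 0))
    (Φ : E → E) (hΦ0 : Φ 0 = 0)
    (ρ ε ε' : ℝ) (hρ0 : 0 ≤ ρ) (hρ1 : ρ < 1) (hε : 0 < ε) (hε' : 0 < ε')
    (h1 : ∀ x : E, ‖x‖ ≤ ε → ‖Φ x‖ ≤ ρ * ‖x‖)
    (h2 : ∀ x : E, ‖x‖ ≤ ε → Φ x ∈ F)
    (h2' : ∀ η > (0 : ℝ), ∃ δ > (0 : ℝ), ∀ x : E, ‖x‖ ≤ δ → nF (Φ x) ≤ η)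
    (h3 : ∀ x ∈ F, nF x ≤ ε' → nF (Φ x) ≤ ρ * nF x) :
    ∀ x₀ : E, ‖x₀‖ ≤ ε →
      Tendsto (fun i : ℕ => ‖Φ^[i] x₀‖) atTop (nhds 0) ∧
      ∃ I : ℕ, (∀ i ≥ I, Φ^[i] x₀ ∈ F ∧ nF (Φ^[i] x₀) ≤ ε') ∧
        Tendsto (fun i : ℕ => nF (Φ^[i] x₀)) atTop (nhds 0) := by
  intro x₀ hx₀
  have hgeom := norm_iterate_le_pow_mul hρ0 hρ1.le h1 hx₀
  have hball (i : ℕ) : ‖Φ^[i] x₀‖ ≤ ε :=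
    (hgeom i).trans
      ((mul_le_of_le_one_left (norm_nonneg x₀) (pow_le_one₀ hρ0 hρ1.le)).trans hx₀)
  have hE : Tendsto (fun i : ℕ => ‖Φ^[i] x₀‖) atTop (nhds 0) := by
    refine squeeze_zero (fun i => norm_nonneg _) hgeom ?_
    simpa using (tendsto_pow_atTop_nhds_zero_of_lt_one hρ0 hρ1).mul_const ‖x₀‖
  have hmem (i : ℕ) : Φ^[i + 1] x₀ ∈ F := by
    rw [Function.iterate_succ_apply']
    exact h2 _ (hball i)
  have hsmall : ∀ η > (0 : ℝ), ∀ᶠ i in atTop, nF (Φ^[i + 1] x₀) ≤ η := by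
    intro η hη
    obtain ⟨δ, hδ, hΦδ⟩ := h2' η hη
    filter_upwards [hE.eventually_le_const hδ] with i hi
    rw [Function.iterate_succ_apply']
    exact hΦδ _ hi
  refine ⟨hE, ?_⟩
  obtain ⟨N, hN⟩ := eventually_atTop.1 (hsmall ε' hε')
  refine ⟨N + 1, fun i hi => ?_, ?_⟩
  · obtain ⟨j, rfl⟩ := Nat.exists_eq_add_of_le' (Nat.le_of_add_left_le hi)
    exact ⟨hmem j, hN j (by omega)⟩
  · rw [← tendsto_add_atTop_iff_nat 1, tendsto_order]
    refine ⟨fun a ha => Eventually.of_forall fun i =>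
      ha.trans_le ((norm_nonneg _).trans (hdom _ (hmem i))), fun a ha => ?_⟩
    filter_upwards [hsmall (a / 2) (half_pos ha)] with i hi
    exact hi.trans_lt (half_lt_self ha)
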